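/- arXiv:2306.02364 — 2 statements merged into one kernel-verified Lean document; each statement's English description precedes it below -/
import Mathlib

section
/- If H1, H2 and H3 are heroes, then Δ(H1,H2,H3) is a rebel. -/
structure Tournament where
  V : Type
  fintype : Fintype V
  adj : V → V → Prop
  asymm : ∀ u v, adj u v → ¬ adj v u
  total : ∀ u v, u ≠ v → adj u v ∨ adj v u

attribute [instance] Tournament.fintype

namespace Tournament

/-- A set of vertices is transitive if it includes no cyclic triangle. -/
def IsTransitiveSet (T : Tournament) (A : Set T.V) : Prop :=
  ∀ a ∈ A, ∀ b ∈ A, ∀ c ∈ A, T.adj a b → T.adj b c → ¬ T.adj c a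

/-- The chromatic number of the subtournament induced on `A`. -/
noncomputable def chiOn (T : Tournament) (A : Set T.V) : ℕ :=
  sInf {k | ∃ C : Fin k → Set T.V, (∀ i, T.IsTransitiveSet (C i)) ∧ A ⊆ ⋃ i, C i}

noncomputable def chi (T : Tournament) : ℕ := T.chiOn Set.univ

def outN (T : Tournament) (v : T.V) : Set T.V := {u | T.adj v u}
def inN (T : Tournament) (v : T.V) : Set T.V := {u | T.adj u v}

/-- The domination number of the subtournament induced on `A`. -/
noncomputable def domOn (T : Tournament) (A : Set T.V) : ℕ :=
  sInf {n | ∃ X : Finset T.V, ↑X ⊆ A ∧ (∀ v ∈ A, v ∉ X → ∃ x ∈ X, T.adj x v) ∧ X.card = n}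

noncomputable def dom (T : Tournament) : ℕ := T.domOn Set.univ

/-- `A ⇒ B`: every edge between `A` and `B` is directed from `A` to `B`. -/
def CompleteTo (T : Tournament) (A B : Set T.V) : Prop :=
  ∀ a ∈ A, ∀ b ∈ B, T.adj a b

def CompletePair (T : Tournament) (A B : Set T.V) : Prop :=
  Disjoint A B ∧ T.CompleteTo A B

/-- `G` has a subtournament inside `A` isomorphic to `H`. -/
def ContainsOn (G : Tournament) (A : Set G.V) (H : Tournament) : Prop :=
  ∃ f : H.V → G.V, Function.Injective f ∧ (∀ u, f u ∈ A) ∧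
    ∀ u v, H.adj u v ↔ G.adj (f u) (f v)

def Contains (G H : Tournament) : Prop := G.ContainsOn Set.univ H

def IsHero (H : Tournament) : Prop :=
  ∃ c > 0, ∀ G : Tournament, ¬ G.Contains H → G.chi < c

def IsRebel (H : Tournament) : Prop :=
  ∃ c > 0, ∀ G : Tournament, ¬ G.Contains H → G.dom < c

/-- The one-vertex tournament. -/
def oneT : Tournament where
  V := PUnit
  fintype := inferInstance
  adj _ _ := False
  asymm := by intro u v h; exact h.elim
  total := by intro u v h; cases u; cases v; exact absurd rfl h

/-- `Δ(H1,H2,H3)`: disjoint copies of `H1,H2,H3` with `A1 ⇒ A2 ⇒ A3 ⇒ A1`. -/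
def delta (H1 H2 H3 : Tournament) : Tournament where
  V := H1.V ⊕ H2.V ⊕ H3.V
  fintype := inferInstance
  adj x y :=
    match x, y with
    | .inl a, .inl b => H1.adj a b
    | .inl _, .inr (.inl _) => True
    | .inl _, .inr (.inr _) => False
    | .inr (.inl _), .inl _ => False
    | .inr (.inl a), .inr (.inl b) => H2.adj a b
    | .inr (.inl _), .inr (.inr _) => True
    | .inr (.inr _), .inl _ => True
    | .inr (.inr _), .inr (.inl _) => False
    | .inr (.inr a), .inr (.inr b) => H3.adj a b
  asymm := by
    rintro (a | a | a) (b | b | b) h <;> simp only at h ⊢ <;>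
      first
        | exact H1.asymm _ _ h
        | exact H2.asymm _ _ h
        | exact H3.asymm _ _ h
        | exact h
        | exact fun h' => h'
  total := by
    rintro (a | a | a) (b | b | b) h <;> simp only at h ⊢ <;>
      first
        | exact H1.total _ _ (by simpa using h)
        | exact H2.total _ _ (by simpa using h)
        | exact H3.total _ _ (by simpa using h)
        | exact Or.inl trivial
        | exact Or.inr trivial

/-- The tournament obtained from disjoint copies of `H1, H2` by directing
all edges from the copy of `H1` to the copy of `H2`. -/
def join2 (H1 H2 : Tournament) : Tournament where
  V := H1.V ⊕ H2.V
  fintype := inferInstance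
  adj x y :=
    match x, y with
    | .inl a, .inl b => H1.adj a b
    | .inl _, .inr _ => True
    | .inr _, .inl _ => False
    | .inr a, .inr b => H2.adj a b
  asymm := by
    rintro (a | a) (b | b) h <;> simp only at h ⊢ <;>
      first
        | exact H1.asymm _ _ h
        | exact H2.asymm _ _ h
        | exact h
        | exact fun h' => h'
  total := by
    rintro (a | a) (b | b) h <;> simp only at h ⊢ <;>
      first
        | exact H1.total _ _ (by simpa using h)
        | exact H2.total _ _ (by simpa using h)
        | exact Or.inl trivial
        | exact Or.inr trivial

end Tournament

namespace Tournament

open Finset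

/-- `S` can be covered by `k` transitive sets. -/
def Col (T : Tournament) (k : ℕ) (S : Finset T.V) : Prop :=
  ∃ C : Fin k → Set T.V, (∀ i, T.IsTransitiveSet (C i)) ∧ ∀ v ∈ S, ∃ i, v ∈ C i

lemma col_of_fintype {T : Tournament} {ι : Type} [Fintype ι] (C : ι → Set T.V)
    (hC : ∀ i, T.IsTransitiveSet (C i)) {S : Finset T.V} (hS : ∀ v ∈ S, ∃ i, v ∈ C i)
    {k : ℕ} (hk : Fintype.card ι ≤ k) : T.Col k S := by
  classical
  let e := Fintype.equivFin ι
  refine ⟨fun j => if h : j.1 < Fintype.card ι then C (e.symm ⟨j.1, h⟩) else ∅, ?_, ?_⟩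
  · intro i
    by_cases h : i.1 < Fintype.card ι
    · simpa [h] using hC _
    · simp only [h, dite_false]
      intro a ha
      exact ha.elim
  · intro v hv
    obtain ⟨i, hi⟩ := hS v hv
    refine ⟨⟨(e i).1, lt_of_lt_of_le (e i).2 hk⟩, ?_⟩
    simpa using hi

lemma Col.mono {T : Tournament} {k : ℕ} {S S' : Finset T.V} (h : T.Col k S) (hs : S' ⊆ S) :
    T.Col k S' := by
  obtain ⟨C, h1, h2⟩ := h
  exact ⟨C, h1, fun v hv => h2 v (hs hv)⟩

lemma Col.mono_k {T : Tournament} {k l : ℕ} {S : Finset T.V} (h : T.Col k S) (hs : k ≤ l) :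
    T.Col l S := by
  obtain ⟨C, h1, h2⟩ := h
  exact col_of_fintype C h1 h2 (by simpa using hs)

lemma Col.cover {T : Tournament} {a b : ℕ} {A B S : Finset T.V} (hA : T.Col a A)
    (hB : T.Col b B) (h : ∀ v ∈ S, v ∈ A ∨ v ∈ B) : T.Col (a + b) S := by
  obtain ⟨C, h1, h2⟩ := hA
  obtain ⟨D, h3, h4⟩ := hB
  refine col_of_fintype (ι := Fin a ⊕ Fin b) (Sum.elim C D) ?_ ?_ (by simp)
  · rintro (i | i)
    · exact h1 i
    · exact h3 i
  · intro v hv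
    rcases h v hv with h | h
    · obtain ⟨i, hi⟩ := h2 v h
      exact ⟨.inl i, hi⟩
    · obtain ⟨i, hi⟩ := h4 v h
      exact ⟨.inr i, hi⟩

lemma irrefl (T : Tournament) (v : T.V) : ¬ T.adj v v := fun h => T.asymm v v h h

lemma isTransitiveSet_singleton (T : Tournament) (v : T.V) : T.IsTransitiveSet {v} := by
  intro a ha b hb c hc hab
  rw [Set.mem_singleton_iff] at ha hb
  subst ha; subst hb
  exact (T.irrefl _ hab).elim

lemma col_card {T : Tournament} {S : Finset T.V} {k : ℕ} (h : #S ≤ k) : T.Col k S := by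
  refine col_of_fintype (ι := S) (fun v => {v.1}) (fun v => T.isTransitiveSet_singleton _) ?_
    (by simpa using h)
  intro v hv
  exact ⟨⟨v, hv⟩, rfl⟩

lemma col_cover_family {T : Tournament} {ι : Type} (I : Finset ι) {c : ℕ}
    (F : ι → Finset T.V) (hF : ∀ i ∈ I, T.Col c (F i)) {S : Finset T.V}
    (hS : ∀ v ∈ S, ∃ i ∈ I, v ∈ F i) {k : ℕ} (hk : #I * c ≤ k) : T.Col k S := by
  classical
  choose! C h1 h2 using hF
  refine col_of_fintype (ι := I × Fin c) (fun p => C p.1 p.2) (fun p => h1 _ p.1.2 _) ?_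
    (by simpa using hk)
  intro v hv
  obtain ⟨i, hi, hv⟩ := hS v hv
  obtain ⟨j, hj⟩ := h2 i hi v hv
  exact ⟨⟨⟨i, hi⟩, j⟩, hj⟩

/-- every vertex of `A` is adjacent to every vertex of `B`. -/
def To (T : Tournament) (A B : Finset T.V) : Prop := ∀ a ∈ A, ∀ b ∈ B, T.adj a b

lemma To.mono {T : Tournament} {A B A' B' : Finset T.V} (h : T.To A B) (hA : A' ⊆ A)
    (hB : B' ⊆ B) : T.To A' B' := fun a ha b hb => h a (hA ha) b (hB hb)

/-- no large-chromatic cyclic triple -/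
def TriFree (T : Tournament) (c : ℕ) : Prop :=
  ∀ A B C : Finset T.V, ¬ T.Col c A → ¬ T.Col c B → ¬ T.Col c C →
    T.To A B → T.To B C → T.To C A → False

/-- The induced subtournament. -/
def ind (T : Tournament) (S : Finset T.V) : Tournament where
  V := {v // v ∈ S}
  fintype := inferInstance
  adj u v := T.adj u.1 v.1
  asymm _ _ h := T.asymm _ _ h
  total _ _ h := T.total _ _ (fun h' => h (Subtype.ext h'))

lemma ind_col {T : Tournament} {S : Finset T.V} {k : ℕ} (h : (T.ind S).chi ≤ k) : T.Col k S := by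
  classical
  have hne : {k | ∃ C : Fin k → Set (T.ind S).V, (∀ i, (T.ind S).IsTransitiveSet (C i)) ∧
      Set.univ ⊆ ⋃ i, C i}.Nonempty := by
    obtain ⟨C, h1, h2⟩ := col_card (T := T.ind S) (S := Finset.univ) le_rfl
    exact ⟨_, C, h1, fun v _ => Set.mem_iUnion.2 (h2 v (Finset.mem_univ v))⟩
  obtain ⟨C, h1, h2⟩ := Nat.sInf_mem hne
  refine Col.mono_k ?_ h
  refine ⟨fun i => {v | ∃ h : v ∈ S, (⟨v, h⟩ : (T.ind S).V) ∈ C i}, ?_, ?_⟩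
  · rintro i a ⟨ha, ha'⟩ b ⟨hb, hb'⟩ c ⟨hc, hc'⟩ hab hbc
    exact h1 i _ ha' _ hb' _ hc' hab hbc
  · intro v hv
    have := h2 (Set.mem_univ (⟨v, hv⟩ : (T.ind S).V))
    obtain ⟨i, hi⟩ := Set.mem_iUnion.1 this
    exact ⟨i, hv, hi⟩

lemma hero_contains {T H : Tournament} {c : ℕ} (hc : ∀ G : Tournament, ¬ G.Contains H → G.chi < c)
    {S : Finset T.V} {k : ℕ} (hk : c ≤ k) (hS : ¬ T.Col k S) :
    ∃ f : H.V → T.V, Function.Injective f ∧ (∀ u, f u ∈ S) ∧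
    ∀ u v, H.adj u v ↔ T.adj (f u) (f v) := by
  by_contra hcon
  apply hS
  apply ind_col
  refine le_trans (le_of_lt (hc _ ?_)) hk
  rintro ⟨f, h1, -, h3⟩
  exact hcon ⟨fun u => (f u).1, fun u v h => h1 (Subtype.ext h), fun u => (f u).2, h3⟩

lemma triFree_of_heroes {H1 H2 H3 : Tournament}
    (h1 : H1.IsHero) (h2 : H2.IsHero) (h3 : H3.IsHero) :
    ∃ c, ∀ T : Tournament, ¬ T.Contains (delta H1 H2 H3) → T.TriFree c := by
  obtain ⟨c1, -, h1⟩ := h1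
  obtain ⟨c2, -, h2⟩ := h2
  obtain ⟨c3, -, h3⟩ := h3
  refine ⟨c1 + c2 + c3, fun T hT A B C hA hB hC hAB hBC hCA => hT ?_⟩
  obtain ⟨f, f1, f2, f3⟩ := hero_contains h1 (by omega) hA
  obtain ⟨g, g1, g2, g3⟩ := hero_contains h2 (by omega) hB
  obtain ⟨k, k1, k2, k3⟩ := hero_contains h3 (by omega) hC
  have fg : ∀ a b, T.adj (f a) (g b) := fun a b => hAB _ (f2 _) _ (g2 _)
  have gk : ∀ a b, T.adj (g a) (k b) := fun a b => hBC _ (g2 _) _ (k2 _)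
  have kf : ∀ a b, T.adj (k a) (f b) := fun a b => hCA _ (k2 _) _ (f2 _)
  have ne : ∀ {a b : T.V}, T.adj a b → a ≠ b := fun h e => T.irrefl _ (e ▸ h)
  refine ⟨Sum.elim f (Sum.elim g k), ?_, fun _ => Set.mem_univ _, ?_⟩
  · rintro (a | a | a) (b | b | b) h <;> simp only [Sum.elim_inl, Sum.elim_inr] at h
    · rw [f1 h]
    · exact (ne (fg a b) h).elim
    · exact (ne (kf b a) h.symm).elim
    · exact (ne (fg b a) h.symm).elim
    · rw [g1 h]
    · exact (ne (gk a b) h).elim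
    · exact (ne (kf a b) h).elim
    · exact (ne (gk b a) h.symm).elim
    · rw [k1 h]
  · rintro (a | a | a) (b | b | b) <;> simp only [Sum.elim_inl, Sum.elim_inr, delta]
    · exact f3 a b
    · simp [fg]
    · simp [T.asymm _ _ (kf b a)]
    · simp [T.asymm _ _ (fg b a)]
    · exact g3 a b
    · simp [gk]
    · simp [kf]
    · simp [T.asymm _ _ (gk b a)]
    · exact k3 a b

/-- Domination is large: no set of at most `n` vertices dominates. -/
def DomL (T : Tournament) (n : ℕ) : Prop :=
  ∀ X : Finset T.V, #X ≤ n → ∃ z, ∀ x ∈ X, T.adj z x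

lemma domL_of_le {T : Tournament} {n : ℕ} (h : n < T.dom) : T.DomL n := by
  intro X hX
  by_contra hcon
  push Not at hcon
  have : T.dom ≤ #X := by
    refine Nat.sInf_le ⟨X, Set.subset_univ _, ?_, rfl⟩
    intro v _ hv
    obtain ⟨x, hx, hvx⟩ := hcon v
    exact ⟨x, hx, (T.total x v (fun e => hv (e ▸ hx))).resolve_right hvx⟩
  omega

end Tournament

namespace Tournament

open Finset

lemma col_drop {T : Tournament} {k : ℕ} {A : Finset T.V} (C : Fin (k + 1) → Set T.V)
    (hC : ∀ i, T.IsTransitiveSet (C i)) (hA : ∀ v ∈ A, ∃ i, v ∈ C i) (i : Fin (k + 1))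
    (hn : ¬ T.Col k A) : ∃ a ∈ A, a ∈ C i := by
  by_contra hcon
  push Not at hcon
  apply hn
  refine col_of_fintype (ι := {j : Fin (k + 1) // j ≠ i}) (fun j => C j.1) (fun j => hC _) ?_ ?_
  · intro v hv
    obtain ⟨j, hj⟩ := hA v hv
    exact ⟨⟨j, fun e => hcon v hv (e ▸ hj)⟩, hj⟩
  · simp

lemma not_col_zero {T : Tournament} {A : Finset T.V} {v : T.V} (h : v ∈ A) : ¬ T.Col 0 A := by
  rintro ⟨C, -, h2⟩
  obtain ⟨i, -⟩ := h2 v h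
  exact i.elim0

lemma nonempty_of_not_col {T : Tournament} {A : Finset T.V} {k : ℕ} (h : ¬ T.Col k A) :
    A.Nonempty := by
  by_contra hcon
  rw [not_nonempty_iff_eq_empty] at hcon
  exact h (col_card (by simp [hcon]))

lemma hltw (k : ℕ) : ∃ K l : ℕ, ∀ (T : Tournament) (Z : Finset T.V),
    (∀ X ⊆ Z, #X ≤ K → ∃ z ∈ Z, ∀ x ∈ X, T.adj z x) →
    ∃ A ⊆ Z, #A ≤ l ∧ ¬ T.Col k A := by
  classical
  induction k with
  | zero =>
    refine ⟨0, 1, fun T Z h => ?_⟩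
    obtain ⟨z, hz, -⟩ := h ∅ (by simp) (by simp)
    exact ⟨{z}, by simpa using hz, by simp, not_col_zero (mem_singleton_self z)⟩
  | succ k ih =>
    obtain ⟨K, l, ih⟩ := ih
    let s := K + l + 1
    let w := (k + 1) * s
    refine ⟨w + K, w + l + w.choose s * l, fun T Z h => ?_⟩
    -- a minimum dominating set
    obtain ⟨D, hD, hmin⟩ := exists_min_image
      (Z.powerset.filter (fun D => ¬ ∃ z ∈ Z, ∀ x ∈ D, T.adj z x)) (fun D => #D)
      ⟨Z, by
        simp only [mem_filter, mem_powerset, subset_refl, true_and]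
        rintro ⟨z, hz, hz'⟩
        exact T.irrefl z (hz' z hz)⟩
    simp only [mem_filter, mem_powerset] at hD hmin
    obtain ⟨hDZ, hDd⟩ := hD
    have hDc : w ≤ #D := by
      by_contra hcon
      exact hDd (h D hDZ (by omega))
    obtain ⟨W, hWD, hWc⟩ := exists_subset_card_eq hDc
    obtain ⟨A, hAZ, hAc, hAn⟩ := ih T (Z.filter (fun z => ∀ x ∈ W, T.adj z x)) (by
      intro X hX hXc
      obtain ⟨z, hz, hz'⟩ := h (W ∪ X)
        (union_subset (hWD.trans hDZ) (hX.trans (filter_subset _ _)))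
        (le_trans (card_union_le _ _) (by omega))
      exact ⟨z, mem_filter.2 ⟨hz, fun x hx => hz' x (mem_union_left _ hx)⟩,
        fun x hx => hz' x (mem_union_right _ hx)⟩)
    have hAW : ∀ a ∈ A, ∀ x ∈ W, T.adj a x := fun a ha => (mem_filter.1 (hAZ ha)).2
    have hY : ∀ S ∈ powersetCard s W, ∃ Y : Finset T.V,
        Y ⊆ Z.filter (fun z => ∀ x ∈ A ∪ (D \ S), T.adj z x) ∧ #Y ≤ l ∧ ¬ T.Col k Y := by
      intro S hS
      obtain ⟨hSW, hSc⟩ := mem_powersetCard.1 hS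
      apply ih T
      intro Y hYZ hYc
      by_contra hcon
      have hYZ' : Y ⊆ Z := hYZ.trans (filter_subset _ _)
      have := hmin (A ∪ (D \ S) ∪ Y) ⟨?_, ?_⟩
      · have e1 := card_union_le (A ∪ (D \ S)) Y
        have e2 := card_union_le A (D \ S)
        have e3 := card_sdiff_of_subset (hSW.trans hWD)
        have e4 := card_le_card (hSW.trans hWD)
        omega
      · exact union_subset (union_subset (hAZ.trans (filter_subset _ _))
          (sdiff_subset.trans hDZ)) hYZ'
      · rintro ⟨z, hz, hz'⟩
        exact hcon ⟨z, mem_filter.2 ⟨hz, fun x hx => hz' x (mem_union_left _ hx)⟩,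
          fun x hx => hz' x (mem_union_right _ hx)⟩
    choose! Y hYZ hYc hYn using hY
    refine ⟨W ∪ A ∪ (powersetCard s W).biUnion Y, ?_, ?_, ?_⟩
    · refine union_subset (union_subset (hWD.trans hDZ) (hAZ.trans (filter_subset _ _))) ?_
      exact biUnion_subset.2 (fun S hS => (hYZ S hS).trans (filter_subset _ _))
    · have e1 := card_union_le (W ∪ A) ((powersetCard s W).biUnion Y)
      have e2 := card_union_le W A
      have e3 := card_biUnion_le_card_mul (powersetCard s W) Y l hYc
      rw [card_powersetCard, hWc] at e3
      omega
    · rintro ⟨C, hC, hcov⟩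
      choose! f hf using hcov
      obtain ⟨i, -, hi⟩ := exists_le_card_fiber_of_mul_le_card_of_maps_to (s := W)
        (t := univ) (f := f) (n := s) (fun _ _ => mem_univ _) ⟨0, mem_univ _⟩ (by simp [hWc, w])
      obtain ⟨S, hSi, hSc⟩ := exists_subset_card_eq hi
      have hSW : S ⊆ W := hSi.trans (filter_subset _ _)
      have hS : S ∈ powersetCard s W := mem_powersetCard.2 ⟨hSW, hSc⟩
      obtain ⟨a, ha, hai⟩ := col_drop (A := A) C hC
        (fun v hv => ⟨f v, hf v (mem_union_left _ (mem_union_right _ hv))⟩) i hAn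
      obtain ⟨y, hy, hyi⟩ := col_drop (A := Y S) C hC
        (fun v hv => ⟨f v, hf v (mem_union_right _ (mem_biUnion.2 ⟨S, hS, hv⟩))⟩) i (hYn S hS)
      obtain ⟨hyZ, hy'⟩ := mem_filter.1 (hYZ S hS hy)
      push Not at hDd
      obtain ⟨x, hxD, hyx⟩ := hDd y hyZ
      have hxS : x ∈ S := by
        by_contra hxS
        exact hyx (hy' x (mem_union_right _ (mem_sdiff.2 ⟨hxD, hxS⟩)))
      have hya := hy' a (mem_union_left _ ha)
      have hax := hAW a ha x (hSW hxS)
      have hxy : T.adj x y := (T.total x y (by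
        rintro rfl
        exact T.asymm _ _ hya hax)).resolve_right hyx
      have hxi : x ∈ C i := by
        have := hf x (mem_union_left _ (mem_union_left _ (hSW hxS)))
        rwa [(mem_filter.1 (hSi hxS)).2] at this
      exact hC i y hyi a hai x hxi hya hax hxy

/-- Out-beating classes -/
lemma exists_lam : ∃ K lam : ℕ → ℕ, ∀ (r n : ℕ) (T : Tournament), T.DomL (n + K r) →
    ∀ X : Finset T.V, #X ≤ n → ∃ R : Finset T.V, #R ≤ lam r ∧ ¬ T.Col r R ∧ T.To R X := by
  classical
  choose K lam h using hltw
  refine ⟨K, lam, fun r n T hT X hX => ?_⟩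
  obtain ⟨A, hA, h1, h2⟩ := h r T (univ.filter (fun z => ∀ x ∈ X, T.adj z x)) (by
    intro Y hY hYc
    obtain ⟨z, hz⟩ := hT (X ∪ Y) (le_trans (card_union_le _ _) (by omega))
    exact ⟨z, mem_filter.2 ⟨mem_univ _, fun x hx => hz x (mem_union_left _ hx)⟩,
      fun x hx => hz x (mem_union_right _ hx)⟩)
  exact ⟨A, h1, h2, fun a ha => (mem_filter.1 (hA ha)).2⟩

end Tournament

namespace Tournament

open Finset

open Classical in
/-- the vertices of the second set that are out-neighbours of all of the first -/
noncomputable def out (T : Tournament) (Q Q' : Finset T.V) : Finset T.V :=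
  Q'.filter (fun v => ∀ q ∈ Q, T.adj q v)

/-- first set hits the second -/
def Hit (T : Tournament) (c : ℕ) (Q Q' : Finset T.V) : Prop := ¬ T.Col c (T.out Q Q')

/-- small sets of large chromatic number -/
def Cls (T : Tournament) (m l : ℕ) (Q : Finset T.V) : Prop := ¬ T.Col m Q ∧ #Q ≤ l

open Classical in
/-- measure of a predicate -/
noncomputable def pr {α : Type} [Fintype α] (r : α → ℝ) (P : α → Prop) : ℝ :=
  ∑ x, r x * (if P x then 1 else 0)

/-- probability distribution supported on a predicate -/
def IsProb {α : Type} [Fintype α] (r : α → ℝ) (S : α → Prop) : Prop :=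
  (∀ x, 0 ≤ r x) ∧ (∑ x, r x = 1) ∧ ∀ x, ¬ S x → r x = 0

/-- losing distribution -/
def Lose (T : Tournament) (c : ℕ) (η : ℝ) (m l m' l' : ℕ) : Prop :=
  ∃ r : Finset T.V → ℝ, IsProb r (T.Cls m' l') ∧ ∀ Q, T.Cls m l Q → pr r (T.Hit c Q) < η

open Classical in
lemma purify {T : Tournament} {c a l : ℕ} {A Q' Q₀ : Finset T.V} (hA : #A ≤ l)
    (hh : ∀ Q ⊆ A, ¬ T.Col a Q → ¬ T.Hit c Q Q') (hQ : Q₀ ⊆ Q')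
    (hn : ¬ T.Col (2 ^ l * c + l) Q₀) :
    ∃ Q₂ ⊆ Q₀, ¬ T.Col c Q₂ ∧ ∃ B ⊆ A, T.Col a (A.filter (fun v => v ∉ B)) ∧ T.To Q₂ B := by
  classical
  let F : Finset T.V → Finset T.V := fun t =>
    (Q₀ \ A).filter (fun v => A.filter (fun x => T.adj x v) = t)
  have : ∃ t ∈ A.powerset, ¬ T.Col c (F t) := by
    by_contra hcon
    push Not at hcon
    apply hn
    have h1 : T.Col (2 ^ l * c) (Q₀ \ A) := by
      refine col_cover_family A.powerset F hcon ?_ ?_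
      · intro v hv
        exact ⟨A.filter (fun x => T.adj x v), mem_powerset.2 (filter_subset _ _),
          mem_filter.2 ⟨hv, rfl⟩⟩
      · rw [card_powerset]
        exact Nat.mul_le_mul_right _ (Nat.pow_le_pow_right (by norm_num) hA)
    refine h1.cover (col_card hA) ?_
    intro v hv
    by_cases h : v ∈ A
    · exact Or.inr h
    · exact Or.inl (mem_sdiff.2 ⟨hv, h⟩)
  obtain ⟨t, ht, hFt⟩ := this
  rw [mem_powerset] at ht
  refine ⟨F t, (filter_subset _ _).trans sdiff_subset, hFt, A \ t, sdiff_subset, ?_, ?_⟩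
  · have hct : T.Col a t := by
      by_contra hcon
      refine hh t ht hcon (fun h => hFt (h.mono ?_))
      intro v hv
      obtain ⟨hv1, hv2⟩ := mem_filter.1 hv
      refine mem_filter.2 ⟨hQ (mem_sdiff.1 hv1).1, fun q hq => ?_⟩
      rw [← hv2] at hq
      exact (mem_filter.1 hq).2
    refine hct.mono ?_
    intro v hv
    obtain ⟨hv1, hv2⟩ := mem_filter.1 hv
    by_contra h
    exact hv2 (mem_sdiff.2 ⟨hv1, h⟩)
  · intro v hv x hx
    obtain ⟨hv1, hv2⟩ := mem_filter.1 hv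
    obtain ⟨hx1, hx2⟩ := mem_sdiff.1 hx
    refine (T.total v x ?_).resolve_right ?_
    · rintro rfl
      exact (mem_sdiff.1 hv1).2 hx1
    · intro h
      apply hx2
      rw [← hv2]
      exact mem_filter.2 ⟨hx1, h⟩

lemma pr_bad {T : Tournament} {c a b l : ℕ} {η : ℝ} (hη : 0 ≤ η) {r : Finset T.V → ℝ}
    (hr : ∀ x, 0 ≤ r x) (h : ∀ Q, T.Cls a b Q → pr r (T.Hit c Q) < η) {A : Finset T.V}
    (hA : #A ≤ l) (hl : l ≤ b) (he : η * 2 ^ l ≤ 1 / 3) :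
    pr r (fun Q' => ∃ Q ⊆ A, ¬ T.Col a Q ∧ T.Hit c Q Q') ≤ 1 / 3 := by
  classical
  let P := A.powerset.filter (fun Q => ¬ T.Col a Q)
  have h1 : pr r (fun Q' => ∃ Q ⊆ A, ¬ T.Col a Q ∧ T.Hit c Q Q') ≤
      ∑ Q ∈ P, pr r (T.Hit c Q) := by
    unfold pr
    rw [sum_comm]
    refine sum_le_sum fun x _ => ?_
    rw [← mul_sum]
    refine mul_le_mul_of_nonneg_left ?_ (hr x)
    split_ifs with hx
    · obtain ⟨Q, hQ, hQ1, hQ2⟩ := hx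
      have := single_le_sum (s := P) (f := fun Q => if T.Hit c Q x then (1 : ℝ) else 0)
        (fun i _ => by positivity) (mem_filter.2 ⟨mem_powerset.2 hQ, hQ1⟩ : Q ∈ P)
      simpa [hQ2] using this
    · exact sum_nonneg fun i _ => by positivity
  have h2 : ∑ Q ∈ P, pr r (T.Hit c Q) ≤ ∑ Q ∈ P, η := by
    refine sum_le_sum fun Q hQ => (h Q ?_).le
    obtain ⟨hQ1, hQ2⟩ := mem_filter.1 hQ
    exact ⟨hQ2, (card_le_card (mem_powerset.1 hQ1)).trans (hA.trans hl)⟩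
  have h3 : (#P : ℝ) ≤ 2 ^ l := by
    have e1 : #P ≤ 2 ^ #A := by
      rw [← card_powerset]
      exact card_le_card (filter_subset _ _)
    have e2 : 2 ^ #A ≤ 2 ^ l := Nat.pow_le_pow_right (by norm_num) hA
    exact_mod_cast e1.trans e2
  rw [sum_const, nsmul_eq_mul] at h2
  nlinarith

lemma lose_lose {T : Tournament} {c a b p q a' b' p' q' : ℕ} {η : ℝ} (hη : 0 ≤ η)
    (ht : T.TriFree c) (h1 : T.Lose c η a b p q) (h2 : T.Lose c η a' b' p' q')
    (hd : ∀ X : Finset T.V, #X ≤ q → ∃ R, T.Cls (a' + c) b' R ∧ T.To R X)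
    (hp' : 2 ^ b' * c + b' + a ≤ p') (hq' : q' ≤ b) (hp : 2 ^ b * c + b ≤ p)
    (e1 : η * 2 ^ b ≤ 1 / 3) (e2 : η * 2 ^ b' ≤ 1 / 3) : False := by
  classical
  obtain ⟨r, ⟨hr0, hr1, hrs⟩, hr⟩ := h1
  obtain ⟨r', ⟨hr0', hr1', hrs'⟩, hr'⟩ := h2
  let bad : Finset T.V → Finset T.V → Prop := fun Q₁ Q₀ =>
    ∃ Q ⊆ Q₁, ¬ T.Col a Q ∧ T.Hit c Q Q₀
  have hQ0 : ∃ Q₀, T.Cls p q Q₀ ∧ pr r' (fun Q₁ => bad Q₁ Q₀) ≤ 1 / 3 := by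
    by_contra hcon
    push Not at hcon
    have s1 : ∑ Q₁, r' Q₁ * pr r (bad Q₁) ≤ ∑ Q₁, r' Q₁ * (1 / 3) := by
      refine sum_le_sum fun Q₁ _ => ?_
      by_cases hc : T.Cls p' q' Q₁
      · exact mul_le_mul_of_nonneg_left (pr_bad hη hr0 hr (hc.2.trans hq') le_rfl e1) (hr0' _)
      · simp [hrs' _ hc]
    have s2 : ∑ Q₁, r' Q₁ * pr r (bad Q₁) = ∑ Q₀, r Q₀ * pr r' (fun Q₁ => bad Q₁ Q₀) := by
      unfold pr
      simp_rw [mul_sum]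
      rw [sum_comm]
      refine sum_congr rfl fun x _ => sum_congr rfl fun y _ => by ring
    have s3 : ∑ Q₀, r Q₀ * (1 / 3) < ∑ Q₀, r Q₀ * pr r' (fun Q₁ => bad Q₁ Q₀) := by
      refine sum_lt_sum (fun Q₀ _ => ?_) ?_
      · by_cases hc : T.Cls p q Q₀
        · exact mul_le_mul_of_nonneg_left (hcon _ hc).le (hr0 _)
        · simp [hrs _ hc]
      · obtain ⟨Q₀, -, hQ⟩ := exists_ne_zero_of_sum_ne_zero (by rw [hr1]; norm_num)
        have hc : T.Cls p q Q₀ := by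
          by_contra hc
          exact hQ (hrs _ hc)
        exact ⟨Q₀, mem_univ _, mul_lt_mul_of_pos_left (hcon _ hc) (lt_of_le_of_ne (hr0 _) hQ.symm)⟩
    rw [← sum_mul, hr1'] at s1
    rw [← sum_mul, hr1] at s3
    linarith
  obtain ⟨Q₀, hQ0, hb0⟩ := hQ0
  obtain ⟨R, hR, hRQ⟩ := hd Q₀ hQ0.2
  have hbR := pr_bad hη hr0' hr' hR.2 le_rfl e2
  have hQ1 : ∃ Q₁, T.Cls p' q' Q₁ ∧ ¬ bad Q₁ Q₀ ∧ ¬ ∃ Q ⊆ R, ¬ T.Col a' Q ∧ T.Hit c Q Q₁ := by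
    by_contra hcon
    have : ∑ Q₁, r' Q₁ ≤ pr r' (fun Q₁ => bad Q₁ Q₀) +
        pr r' (fun Q' => ∃ Q ⊆ R, ¬ T.Col a' Q ∧ T.Hit c Q Q') := by
      unfold pr
      rw [← sum_add_distrib]
      refine sum_le_sum fun Q₁ _ => ?_
      by_cases hc : T.Cls p' q' Q₁
      · have h0 := hr0' Q₁
        by_cases hb : bad Q₁ Q₀
        · rw [if_pos hb]
          split_ifs <;> linarith
        · have : ∃ Q ⊆ R, ¬ T.Col a' Q ∧ T.Hit c Q Q₁ := by
            by_contra h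
            exact hcon ⟨Q₁, hc, hb, h⟩
          rw [if_neg hb, if_pos this]
          linarith
      · simp [hrs' _ hc]
    rw [hr1'] at this
    linarith
  obtain ⟨Q₁, hQ1, hg0, hgR⟩ := hQ1
  obtain ⟨Q₀', hs0, hn0, B, hB, hBc, hto0⟩ := purify (A := Q₁) (Q' := Q₀) (Q₀ := Q₀)
    (hQ1.2.trans hq') (fun Q hQ hQn hh => hg0 ⟨Q, hQ, hQn, hh⟩) subset_rfl
    (fun h => hQ0.1 (h.mono_k hp))
  have hBn : ¬ T.Col (2 ^ b' * c + b') B := by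
    intro h
    refine hQ1.1 (Col.mono_k (h.cover hBc ?_) hp')
    intro v hv
    by_cases hvB : v ∈ B
    · exact Or.inl hvB
    · exact Or.inr (mem_filter.2 ⟨hv, hvB⟩)
  obtain ⟨Q₁', hs1, hn1, B', hB', hBc', hto1⟩ := purify (A := R) (Q' := Q₁) (Q₀ := B)
    hR.2 (fun Q hQ hQn hh => hgR ⟨Q, hQ, hQn, hh⟩) hB hBn
  refine ht Q₀' Q₁' B' hn0 hn1 ?_ (hto0.mono subset_rfl hs1) hto1 (hRQ.mono hB' hs0)
  intro h
  refine hR.1 (Col.mono_k (h.cover hBc' ?_) (by omega))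
  intro v hv
  by_cases hvB : v ∈ B'
  · exact Or.inl hvB
  · exact Or.inr (mem_filter.2 ⟨hv, hvB⟩)

end Tournament

namespace Tournament

open Finset

lemma minimax {α : Type} [Fintype α] (M : α → α → Prop) (P R : α → Prop) (η : ℝ)
    (hR : ∃ j, R j) :
    (∃ π, IsProb π P ∧ ∀ j, R j → η ≤ pr π (fun i => M i j)) ∨
    (∃ r, IsProb r R ∧ ∀ i, P i → pr r (M i) < η) := by
  classical
  by_cases hP : ∃ i, P i
  swap
  · right
    obtain ⟨j, hj⟩ := hR
    refine ⟨Pi.single j 1, ⟨fun x => ?_, by simp, fun x hx => ?_⟩, fun i hi => (hP ⟨i, hi⟩).elim⟩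
    · by_cases h : x = j
      · subst h; simp
      · simp [h]
    · have : x ≠ j := by
        rintro rfl
        exact hx hj
      simp [this]
  obtain ⟨i₀, hi₀⟩ := hP
  let m : Matrix α α ℝ := fun i j => if M i j then 1 else 0
  let L : (α → ℝ) →ₗ[ℝ] (α → ℝ) := Matrix.vecMulLinear m
  have hL : ∀ v j, L v j = pr v (fun i => M i j) := by
    intro v j
    simp only [L, pr, m]
    rfl
  let S : Set (α → ℝ) := stdSimplex ℝ α ∩ {v | ∀ i, ¬ P i → v i = 0}
  let t : Set (α → ℝ) := {y | ∀ j, R j → η ≤ y j}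
  have hSconv : Convex ℝ S := by
    refine (convex_stdSimplex ℝ α).inter ?_
    intro x hx y hy a b _ _ _ i hi
    simp [hx i hi, hy i hi]
  have hScomp : IsCompact S := by
    refine (isCompact_stdSimplex ℝ α).inter_right ?_
    simp only [Set.ofPred_forall]
    refine isClosed_iInter fun i => isClosed_iInter fun _ => ?_
    exact isClosed_eq (continuous_apply i) continuous_const
  have htconv : Convex ℝ t := by
    intro x hx y hy a b ha hb hab j hj
    have e1 := hx j hj
    have e2 := hy j hj
    simp only [Pi.add_apply, Pi.smul_apply, smul_eq_mul]
    have : η = a * η + b * η := by rw [← add_mul, hab, one_mul]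
    rw [this]
    gcongr
  have htcl : IsClosed t := by
    simp only [t, Set.ofPred_forall]
    refine isClosed_iInter fun i => isClosed_iInter fun _ => ?_
    exact isClosed_le continuous_const (continuous_apply i)
  by_cases hdis : Disjoint (Set.image L S) t
  swap
  · left
    rw [Set.not_disjoint_iff] at hdis
    obtain ⟨y, ⟨v, hv, rfl⟩, hy⟩ := hdis
    refine ⟨v, ⟨hv.1.1, hv.1.2, hv.2⟩, fun j hj => ?_⟩
    rw [← hL]
    exact hy j hj
  right
  obtain ⟨f, u, w, hfu, huw, hfw⟩ := geometric_hahn_banach_compact_closed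
    (hSconv.linear_image L) (hScomp.image L.continuous_of_finiteDimensional) htconv htcl hdis
  let g : α → ℝ := fun j => f (Pi.single j 1)
  have hf : ∀ y, f y = ∑ j, y j * g j := by
    intro y
    conv_lhs => rw [← Finset.univ_sum_single y]
    rw [map_sum]
    refine sum_congr rfl fun j _ => ?_
    have : (Pi.single j (y j) : α → ℝ) = y j • Pi.single j 1 := by
      rw [← Pi.single_smul]; simp
    rw [this, map_smul, smul_eq_mul]
  let y0 : α → ℝ := fun _ => η
  have hline : ∀ j x, (R j → 0 ≤ x) → w < f y0 + x * g j := by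
    intro j x hx
    have := hfw (y0 + x • Pi.single j 1) (by
      intro k hk
      by_cases hkj : k = j
      · subst hkj
        simpa [y0] using hx hk
      · simp [y0, hkj])
    rwa [map_add, map_smul, smul_eq_mul] at this
  have hg0 : ∀ j, 0 ≤ g j := by
    intro j
    by_contra hcon
    push Not at hcon
    have hw := hline j 0 (fun _ => le_rfl)
    have := hline j ((f y0 - w) / (- g j)) (fun _ => div_nonneg (by linarith) (by linarith))
    have e : (f y0 - w) / (- g j) * g j = -(f y0 - w) := by
      have := hcon.ne
      field_simp
    rw [e] at this
    linarith
  have hgR : ∀ j, ¬ R j → g j = 0 := by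
    intro j hj
    by_contra hcon
    have := hline j (-(f y0 - w) / g j) (fun h => (hj h).elim)
    rw [div_mul_cancel₀ _ hcon] at this
    linarith
  have hrow : ∀ i, P i → ∑ j, g j * m i j < u := by
    intro i hi
    have := hfu (L (Pi.single i 1)) ⟨_, ⟨single_mem_stdSimplex ℝ i, ?_⟩, rfl⟩
    · rw [hf] at this
      refine lt_of_eq_of_lt (sum_congr rfl fun j _ => ?_) this
      simp [L, mul_comm]
    · intro k hk
      have : k ≠ i := by
        rintro rfl
        exact hk hi
      simp [this]
  let G := ∑ j, g j
  have hy0 : w < η * G := by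
    have := hfw y0 (fun _ _ => le_rfl)
    rw [hf] at this
    simpa [y0, G, mul_sum] using this
  have hG : 0 < G := by
    refine lt_of_le_of_ne (sum_nonneg fun j _ => hg0 j) (fun h => ?_)
    have hz : ∀ j, g j = 0 := fun j =>
      (sum_eq_zero_iff_of_nonneg (fun j _ => hg0 j)).1 h.symm j (mem_univ j)
    have := hrow i₀ hi₀
    simp only [hz, zero_mul, sum_const_zero] at this
    rw [← h, mul_zero] at hy0
    linarith
  refine ⟨fun j => g j / G, ⟨fun j => div_nonneg (hg0 j) hG.le, ?_, fun j hj => by simp [hgR j hj]⟩,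
    fun i hi => ?_⟩
  · rw [← sum_div]
    exact div_self hG.ne'
  · have := hrow i hi
    have e : pr (fun j => g j / G) (M i) = (∑ j, g j * m i j) / G := by
      unfold pr
      rw [sum_div]
      refine sum_congr rfl fun j _ => ?_
      simp only [m]
      split_ifs <;> ring
    rw [e, div_lt_iff₀ hG]
    linarith

lemma pr_mono {α : Type} [Fintype α] {r : α → ℝ} (hr : ∀ x, 0 ≤ r x) {P Q : α → Prop}
    (h : ∀ x, P x → Q x) : pr r P ≤ pr r Q := by
  unfold pr
  refine sum_le_sum fun x _ => mul_le_mul_of_nonneg_left ?_ (hr x)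
  by_cases hp : P x
  · simp [hp, h x hp]
  · simp only [hp, if_false]
    positivity

lemma pr_nonneg {α : Type} [Fintype α] {r : α → ℝ} (hr : ∀ x, 0 ≤ r x) (P : α → Prop) :
    0 ≤ pr r P := by
  unfold pr
  refine sum_nonneg fun x _ => mul_nonneg (hr x) (by positivity)

lemma win_win {T : Tournament} {c a b p q m l s u t : ℕ} {η : ℝ} (hη : 0 < η) (hη1 : η ≤ 1)
    (ht : T.TriFree c) (h1 : ¬ T.Lose c η a b p q) (h2 : ¬ T.Lose c η m l s u)
    (hpm : p ≤ m) (hlq : l ≤ q) (hac : c ≤ a) (hte : (1 - η) ^ t < η)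
    (hd : ∀ X : Finset T.V, #X ≤ t * b → ∃ R, T.Cls s u R ∧ T.To R X) : False := by
  classical
  obtain ⟨π, ⟨hπ0, hπ1, hπs⟩, hπ⟩ :=
    (minimax (T.Hit c) (T.Cls m l) (T.Cls s u) η (by
      obtain ⟨R, hR, -⟩ := hd ∅ (by simp)
      exact ⟨R, hR⟩)).resolve_right h2
  have hgreedy : ∀ n : ℕ, ∃ F : Finset (Finset T.V), #F ≤ n ∧ (∀ Q ∈ F, T.Cls a b Q) ∧
      pr π (fun Q' => ∀ Q ∈ F, ¬ T.Hit c Q Q') ≤ (1 - η) ^ n := by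
    intro n
    induction n with
    | zero =>
      refine ⟨∅, by simp, by simp, ?_⟩
      simp [pr, hπ1]
    | succ n ih =>
      obtain ⟨F, hF, hFc, hFp⟩ := ih
      let un : Finset T.V → Prop := fun Q' => ∀ Q ∈ F, ¬ T.Hit c Q Q'
      let w := pr π un
      have hw0 : 0 ≤ w := pr_nonneg hπ0 _
      have hη2 : 0 ≤ 1 - η := by linarith
      rcases hw0.eq_or_lt with hw | hw
      · refine ⟨F, by omega, hFc, ?_⟩
        change w ≤ _
        rw [← hw]
        positivity
      have : ∃ Q, T.Cls a b Q ∧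
          η ≤ pr (fun Q' => π Q' * (if un Q' then 1 else 0) / w) (T.Hit c Q) := by
        by_contra hcon
        push Not at hcon
        refine h1 ⟨_, ⟨fun x => ?_, ?_, fun x hx => ?_⟩, hcon⟩
        · exact div_nonneg (mul_nonneg (hπ0 x) (by positivity)) hw0
        · rw [← sum_div, div_eq_one_iff_eq hw.ne']
          simp only [w]
          unfold pr
          refine sum_congr rfl fun x _ => ?_
          by_cases hu : un x <;> simp [hu]
        · have : ¬ T.Cls m l x := fun h => hx ⟨fun h' => h.1 (h'.mono_k hpm), h.2.trans hlq⟩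
          simp [hπs x this]
      obtain ⟨Q, hQ, hQη⟩ := this
      refine ⟨insert Q F, (card_insert_le _ _).trans (by omega), ?_, ?_⟩
      · intro Q' hQ'
        rcases mem_insert.1 hQ' with rfl | h
        · exact hQ
        · exact hFc _ h
      · have e1 : pr (fun Q' => π Q' * (if un Q' then 1 else 0) / w) (T.Hit c Q) * w =
            pr π (fun Q' => un Q' ∧ T.Hit c Q Q') := by
          unfold pr
          rw [sum_mul]
          refine sum_congr rfl fun x _ => ?_
          by_cases hu : un x <;> by_cases hh : T.Hit c Q x <;> simp [hu, hh, hw.ne']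
        have e2 : pr π (fun Q' => ∀ P ∈ insert Q F, ¬ T.Hit c P Q') +
            pr π (fun Q' => un Q' ∧ T.Hit c Q Q') = w := by
          simp only [w]
          unfold pr
          rw [← sum_add_distrib]
          refine sum_congr rfl fun x _ => ?_
          rw [← mul_add]
          congr 1
          have this : (∀ P ∈ insert Q F, ¬ T.Hit c P x) ↔ (¬ T.Hit c Q x ∧ un x) := by
            simp [un]
          beta_reduce
          by_cases hu : un x <;> by_cases hh : T.Hit c Q x <;>
            simp only [this, hu, hh] <;> simp
        have e3 : η * w ≤ pr π (fun Q' => un Q' ∧ T.Hit c Q Q') := by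
          rw [← e1]
          exact mul_le_mul_of_nonneg_right hQη hw0
        have e4 : (1 - η) * w ≤ (1 - η) ^ (n + 1) := by
          rw [pow_succ, mul_comm]
          exact mul_le_mul_of_nonneg_right hFp hη2
        linarith
  obtain ⟨F, hF, hFc, hFp⟩ := hgreedy t
  obtain ⟨R, hR, hRX⟩ := hd (F.biUnion id)
    ((card_biUnion_le_card_mul F id b (fun Q hQ => (hFc Q hQ).2)).trans
      (Nat.mul_le_mul_right _ hF))
  have : ∃ Q', T.Hit c Q' R ∧ ∃ Q ∈ F, T.Hit c Q Q' := by
    by_contra hcon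
    push Not at hcon
    have e1 := pr_mono hπ0 hcon
    have e2 := hπ R hR
    linarith
  obtain ⟨Q', hQR, Q, hQF, hQQ⟩ := this
  refine ht Q (T.out Q Q') (T.out Q' R) (fun h => (hFc Q hQF).1 (h.mono_k hac)) hQQ hQR ?_ ?_ ?_
  · intro x hx y hy
    exact (mem_filter.1 hy).2 x hx
  · intro x hx y hy
    exact (mem_filter.1 hy).2 x (mem_filter.1 hx).1
  · intro x hx y hy
    exact hRX x (mem_filter.1 hx).1 y (mem_biUnion.2 ⟨Q, hQF, hy⟩)

end Tournament

namespace Tournament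

open Finset

lemma DomL.mono {T : Tournament} {n k : ℕ} (h : T.DomL n) (hk : k ≤ n) : T.DomL k :=
  fun X hX => h X (hX.trans hk)

lemma tier {K lam : ℕ → ℕ} (hlam : ∀ (r n : ℕ) (T : Tournament), T.DomL (n + K r) →
    ∀ X : Finset T.V, #X ≤ n → ∃ R : Finset T.V, #R ≤ lam r ∧ ¬ T.Col r R ∧ T.To R X)
    (c : ℕ) (W : ℕ → ℕ) (m : ℕ) : ∃ B p₁ p₂ N : ℕ, ∀ η : ℝ, 0 ≤ η → η * 2 ^ B ≤ 1 / 3 →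
      ∀ T : Tournament, T.TriFree c → T.DomL N →
      ∃ l ≤ B, ∃ p, (p = p₁ ∨ p = p₂) ∧ ¬ T.Lose c η m l p (W p) := by
  let b' := lam (m + c)
  let p' := 2 ^ b' * c + b' + m
  let b := W p'
  let p := 2 ^ b * c + b
  refine ⟨max b b', p, p', W p + K (m + c), fun η hη hηB T ht hd => ?_⟩
  by_contra hcon
  push Not at hcon
  have h1 := hcon b (le_max_left _ _) p (Or.inl rfl)
  have h2 := hcon b' (le_max_right _ _) p' (Or.inr rfl)
  refine lose_lose hη ht h1 h2 ?_ le_rfl le_rfl le_rfl ?_ ?_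
  · intro X hX
    obtain ⟨R, e1, e2, e3⟩ := hlam _ _ T hd X hX
    exact ⟨R, ⟨e2, e1⟩, e3⟩
  · refine le_trans (mul_le_mul_of_nonneg_left ?_ hη) hηB
    exact pow_le_pow_right₀ (by norm_num) (le_max_left _ _)
  · refine le_trans (mul_le_mul_of_nonneg_left ?_ hη) hηB
    exact pow_le_pow_right₀ (by norm_num) (le_max_right _ _)

lemma main_bound (c : ℕ) : ∃ N, ∀ T : Tournament, T.TriFree c → ¬ T.DomL N := by
  obtain ⟨K, lam, hlam⟩ := exists_lam
  choose B s₁ s₂ N hB using tier hlam c lam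
  obtain ⟨B₁, p₁, p₂, N₁, h₁⟩ := tier hlam c B c
  let E := B₁ + B p₁ + B p₂
  let η : ℝ := 1 / (3 * 2 ^ E)
  have hη : 0 < η := by positivity
  have hηE : ∀ b ≤ E, η * 2 ^ b ≤ 1 / 3 := by
    intro b hb
    have : η * 2 ^ E = 1 / 3 := by
      simp only [η]
      field_simp
    rw [← this]
    exact mul_le_mul_of_nonneg_left (pow_le_pow_right₀ (by norm_num) hb) hη.le
  have hη1 : η ≤ 1 := by
    have := hηE 0 (Nat.zero_le _)
    rw [pow_zero] at this
    linarith
  obtain ⟨t, ht⟩ := exists_pow_lt_of_lt_one hη (by linarith : 1 - η < 1)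
  refine ⟨N₁ + N p₁ + N p₂ + (t * B₁ + (K (s₁ p₁) + K (s₂ p₁) + K (s₁ p₂) + K (s₂ p₂))),
    fun T hT hd => ?_⟩
  obtain ⟨l₁, hl₁, p, hp, hw₁⟩ := h₁ η hη.le (hηE _ (by omega)) T hT (hd.mono (by omega))
  have hBp : B p ≤ E := by
    rcases hp with rfl | rfl <;> omega
  have hNp : N p ≤ N p₁ + N p₂ := by
    rcases hp with rfl | rfl <;> omega
  obtain ⟨l, hl, s, hs, hw₂⟩ := hB p η hη.le (hηE _ hBp) T hT (hd.mono (by omega))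
  have hKs : K s ≤ K (s₁ p₁) + K (s₂ p₁) + K (s₁ p₂) + K (s₂ p₂) := by
    rcases hp with rfl | rfl <;> rcases hs with rfl | rfl <;> omega
  refine win_win hη hη1 hT hw₁ hw₂ le_rfl hl le_rfl ht ?_
  intro X hX
  obtain ⟨R, e1, e2, e3⟩ := hlam s (t * B₁) T (hd.mono (by omega)) X
    (hX.trans (Nat.mul_le_mul_left _ hl₁))
  exact ⟨R, ⟨e2, e1⟩, e3⟩

end Tournament

/-- If `H1, H2, H3` are heroes then `Δ(H1,H2,H3)` is a rebel. -/
theorem delta_of_heroes_is_rebel (H1 H2 H3 : Tournament)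
    (h1 : H1.IsHero) (h2 : H2.IsHero) (h3 : H3.IsHero) :
    (Tournament.delta H1 H2 H3).IsRebel := by
  obtain ⟨c, hc⟩ := Tournament.triFree_of_heroes h1 h2 h3
  obtain ⟨N, hN⟩ := Tournament.main_bound c
  refine ⟨N + 1, Nat.succ_pos N, fun G hG => ?_⟩
  by_contra hcon
  exact hN G (hc G hG) (Tournament.domL_of_le (by omega))
end

section
/- Suppose that for every integer c ≥ 0 there exist integers K, k ≥ 1 such that every tournament with domination number at least K contains a subtournament on at most k vertices having domination number at least c. Then for every integer t ≥ 1 there exists K such that every T_t-free tournament has domination number at most K, where T_1 is the one-vertex tournament and T_t = Δ(T_{t-1}, T_{t-1}, T_{t-1}) for t ≥ 2. -/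
namespace Tournament

/-- `tAux 0` is the one-vertex tournament `T_1`, and `tAux t` is
`T_{t+1} = Δ(T_t, T_t, T_t)`. -/
def tAux : ℕ → Tournament
  | 0 => oneT
  | (t+1) => delta (tAux t) (tAux t) (tAux t)

end Tournament

namespace Tournament

theorem irrefl' (G : Tournament) (v : G.V) : ¬ G.adj v v := fun h => G.asymm v v h h

/-- A dominating set bounds the domination number. -/
theorem domOn_le (G : Tournament) (A : Set G.V) (X : Finset G.V) (hX : ↑X ⊆ A)
    (h : ∀ v ∈ A, v ∉ X → ∃ x ∈ X, G.adj x v) : G.domOn A ≤ X.card :=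
  Nat.sInf_le ⟨X, hX, h, rfl⟩

theorem exists_domOn (G : Tournament) (A : Set G.V) :
    ∃ X : Finset G.V, ↑X ⊆ A ∧ (∀ v ∈ A, v ∉ X → ∃ x ∈ X, G.adj x v) ∧ X.card = G.domOn A := by
  classical
  have hne : {n | ∃ X : Finset G.V, ↑X ⊆ A ∧ (∀ v ∈ A, v ∉ X → ∃ x ∈ X, G.adj x v) ∧
      X.card = n}.Nonempty := by
    refine ⟨_, A.toFinite.toFinset, ?_, ?_, rfl⟩
    · simp
    · intro v hv hv'
      simp [hv] at hv'
  exact Nat.sInf_mem hne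

theorem domOn_biUnion_le (G : Tournament) {ι : Type*} (s : Finset ι) (S : ι → Set G.V) (n : ℕ)
    (h : ∀ i ∈ s, G.domOn (S i) ≤ n) : G.domOn (⋃ i ∈ s, S i) ≤ s.card * n := by
  classical
  choose X hX1 hX2 hX3 using fun i => G.exists_domOn (S i)
  refine (G.domOn_le _ (s.biUnion X) ?_ ?_).trans ?_
  · intro v hv
    simp only [Finset.coe_biUnion, Set.mem_iUnion] at hv ⊢
    obtain ⟨i, hi, hv⟩ := hv
    exact ⟨i, hi, hX1 i hv⟩
  · intro v hv hv'
    simp only [Set.mem_iUnion] at hv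
    obtain ⟨i, hi, hv⟩ := hv
    have : v ∉ X i := fun h' => hv' (Finset.mem_biUnion.2 ⟨i, hi, h'⟩)
    obtain ⟨x, hx, hxv⟩ := hX2 i v hv this
    exact ⟨x, Finset.mem_biUnion.2 ⟨i, hi, hx⟩, hxv⟩
  · exact Finset.card_biUnion_le_card_mul _ _ _ (fun i hi => (hX3 i).trans_le (h i hi))

theorem domOn_union_le (G : Tournament) (A B : Set G.V) :
    G.domOn (A ∪ B) ≤ G.domOn A + G.domOn B := by
  classical
  obtain ⟨X, hX1, hX2, hX3⟩ := G.exists_domOn A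
  obtain ⟨Y, hY1, hY2, hY3⟩ := G.exists_domOn B
  refine (G.domOn_le _ (X ∪ Y) ?_ ?_).trans ((Finset.card_union_le _ _).trans (by omega))
  · rw [Finset.coe_union]
    exact Set.union_subset_union hX1 hY1
  · intro v hv hv'
    rw [Finset.mem_union, not_or] at hv'
    rcases hv with hv | hv
    · obtain ⟨x, hx, h⟩ := hX2 v hv hv'.1
      exact ⟨x, Finset.mem_union_left _ hx, h⟩
    · obtain ⟨x, hx, h⟩ := hY2 v hv hv'.2
      exact ⟨x, Finset.mem_union_right _ hx, h⟩

theorem domOn_le_card (G : Tournament) (A : Set G.V) (X : Finset G.V) (h : A ⊆ X) :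
    G.domOn A ≤ X.card := by
  classical
  refine (G.domOn_le A (X.filter (· ∈ A)) ?_ ?_).trans (Finset.card_filter_le _ _)
  · intro v hv
    simp at hv
    exact hv.2
  · intro v hv hv'
    exact absurd (Finset.mem_filter.2 ⟨h hv, hv⟩) hv'

/-- The induced subtournament. -/
noncomputable def indOn (G : Tournament) (A : Set G.V) : Tournament where
  V := A
  fintype := Fintype.ofFinite A
  adj u v := G.adj u v
  asymm u v h := G.asymm u v h
  total u v h := G.total u v (fun h' => h (Subtype.ext h'))

theorem domOn_image_le (H G : Tournament) (f : H.V → G.V) (hf : Function.Injective f)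
    (hadj : ∀ u v, H.adj u v ↔ G.adj (f u) (f v)) (S : Set H.V) :
    H.domOn S ≤ G.domOn (f '' S) ∧ G.domOn (f '' S) ≤ H.domOn S := by
  classical
  constructor
  · obtain ⟨X, hX1, hX2, hX3⟩ := G.exists_domOn (f '' S)
    have hc : (X.preimage f hf.injOn).card ≤ X.card := by
      rw [← Finset.card_image_of_injective _ hf]
      exact Finset.card_le_card (fun y hy => by
        obtain ⟨x, hx, rfl⟩ := Finset.mem_image.1 hy
        simpa using hx)
    refine (H.domOn_le S (X.preimage f hf.injOn) ?_ ?_).trans (hc.trans hX3.le)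
    · intro v hv
      have hv : f v ∈ X := by simpa using hv
      obtain ⟨w, hw, e⟩ := hX1 hv
      exact hf e ▸ hw
    · intro v hv hv'
      have hv' : f v ∉ X := by simpa using hv'
      obtain ⟨x, hx, h⟩ := hX2 (f v) ⟨v, hv, rfl⟩ hv'
      obtain ⟨w, hw, rfl⟩ := hX1 hx
      exact ⟨w, by simpa using hx, (hadj _ _).2 h⟩
  · obtain ⟨X, hX1, hX2, hX3⟩ := H.exists_domOn S
    refine (G.domOn_le _ (X.image f) ?_ ?_).trans (Finset.card_image_le.trans hX3.le)
    · rw [Finset.coe_image]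
      exact Set.image_mono hX1
    · rintro _ ⟨v, hv, rfl⟩ hv'
      have : v ∉ X := fun h => hv' (Finset.mem_image_of_mem f h)
      obtain ⟨x, hx, h⟩ := hX2 v hv this
      exact ⟨f x, Finset.mem_image_of_mem f hx, (hadj _ _).1 h⟩

theorem dom_indOn (G : Tournament) (A : Set G.V) : (G.indOn A).dom = G.domOn A := by
  have h := domOn_image_le (G.indOn A) G (fun v => v.1) Subtype.val_injective
    (fun _ _ => Iff.rfl) Set.univ
  have e : (fun v : (G.indOn A).V => v.1) '' Set.univ = A := by
    rw [Set.image_univ]; exact Subtype.range_coe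
  rw [e] at h
  exact le_antisymm h.1 h.2

theorem hyp_on {c K k : ℕ} (h : ∀ G : Tournament, K ≤ G.dom →
      ∃ A : Finset G.V, A.card ≤ k ∧ c ≤ G.domOn ↑A)
    (G : Tournament) (B : Set G.V) (hB : K ≤ G.domOn B) :
    ∃ A : Finset G.V, ↑A ⊆ B ∧ A.card ≤ k ∧ c ≤ G.domOn ↑A := by
  classical
  obtain ⟨A, hA, hc⟩ := h (G.indOn B) (by rw [dom_indOn]; exact hB)
  refine ⟨A.image (fun v => v.1), ?_, Finset.card_image_le.trans hA, ?_⟩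
  · intro v hv
    simp only [Finset.coe_image] at hv
    obtain ⟨w, _, rfl⟩ := hv
    exact w.2
  · have h := domOn_image_le (G.indOn B) G (fun v => v.1) Subtype.val_injective
      (fun _ _ => Iff.rfl) ↑A
    rw [Finset.coe_image]
    exact hc.trans h.1

theorem containsOn_of {T : Tournament} {D : ℕ}
    (h : ∀ G : Tournament, ¬ G.Contains T → G.dom ≤ D)
    (G : Tournament) (A : Set G.V) (hA : D < G.domOn A) : G.ContainsOn A T := by
  by_contra hn
  have := h (G.indOn A) (by
    rintro ⟨f, hf, _, hadj⟩
    exact hn ⟨fun u => (f u).1, fun a b e => hf (Subtype.ext e), fun u => (f u).2, hadj⟩)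
  rw [dom_indOn] at this
  omega

theorem contains_delta {G T : Tournament} {A B C : Set G.V}
    (hA : G.ContainsOn A T) (hB : G.ContainsOn B T) (hC : G.ContainsOn C T)
    (hAB : G.CompleteTo A B) (hBC : G.CompleteTo B C) (hCA : G.CompleteTo C A) :
    G.Contains (delta T T T) := by
  obtain ⟨f, hf, hfA, hfa⟩ := hA
  obtain ⟨g, hg, hgB, hga⟩ := hB
  obtain ⟨k, hk, hkC, hka⟩ := hC
  have h1 : ∀ u v, G.adj (f u) (g v) := fun u v => hAB _ (hfA u) _ (hgB v)
  have h2 : ∀ u v, G.adj (g u) (k v) := fun u v => hBC _ (hgB u) _ (hkC v)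
  have h3 : ∀ u v, G.adj (k u) (f v) := fun u v => hCA _ (hkC u) _ (hfA v)
  have n1 : ∀ u v, f u ≠ g v := fun u v e => G.irrefl' _ (e ▸ h1 u v)
  have n2 : ∀ u v, g u ≠ k v := fun u v e => G.irrefl' _ (e ▸ h2 u v)
  have n3 : ∀ u v, k u ≠ f v := fun u v e => G.irrefl' _ (e ▸ h3 u v)
  refine ⟨Sum.elim f (Sum.elim g k), ?_, fun _ => trivial, ?_⟩
  · rintro (a | a | a) (b | b | b) e <;> simp only [Sum.elim_inl, Sum.elim_inr] at e
    · rw [hf e]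
    · exact absurd e (n1 _ _)
    · exact absurd e.symm (n3 _ _)
    · exact absurd e.symm (n1 _ _)
    · rw [hg e]
    · exact absurd e (n2 _ _)
    · exact absurd e (n3 _ _)
    · exact absurd e.symm (n2 _ _)
    · rw [hk e]
  · rintro (a | a | a) (b | b | b) <;> simp only [delta, Sum.elim_inl, Sum.elim_inr]
    · exact hfa a b
    · simp [h1]
    · simpa using G.asymm _ _ (h3 b a)
    · simpa using G.asymm _ _ (h1 b a)
    · exact hga a b
    · simp [h2]
    · simp [h3]
    · simpa using G.asymm _ _ (h2 b a)
    · exact hka a b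

/-- The property that every tournament pair of large sets has homogeneous large subsets. -/
theorem homog
    (hyp : ∀ c : ℕ, ∃ K k : ℕ, 1 ≤ K ∧ 1 ≤ k ∧ ∀ G : Tournament, K ≤ G.dom →
      ∃ A : Finset G.V, A.card ≤ k ∧ c ≤ G.domOn ↑A) (n : ℕ) :
    ∃ N : ℕ, n ≤ N ∧ ∀ (G : Tournament) (A B : Set G.V), N ≤ G.domOn A → N ≤ G.domOn B →
      ∃ A' B' : Set G.V, A' ⊆ A ∧ B' ⊆ B ∧ n ≤ G.domOn A' ∧ n ≤ G.domOn B' ∧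
        (G.CompleteTo A' B' ∨ G.CompleteTo B' A') := by
  classical
  obtain ⟨K, k, -, -, h⟩ := hyp (2 * n)
  refine ⟨n + K + k + 2 ^ k * n + 1, by omega, ?_⟩
  intro G A B hA hB
  obtain ⟨X, hXA, hXk, hXn⟩ := hyp_on h G A (by omega)
  let cls : Finset G.V → Set G.V := fun P =>
    {v | v ∈ B ∧ v ∉ X ∧ ∀ x ∈ X, x ∈ P ↔ G.adj v x}
  have hex : ∃ P ∈ X.powerset, n ≤ G.domOn (cls P) := by
    by_contra hcon
    push Not at hcon
    have h1 := G.domOn_biUnion_le X.powerset cls n (fun P hP => (hcon P hP).le)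
    have h2 : G.domOn (B ∩ X) ≤ X.card := G.domOn_le_card _ X Set.inter_subset_right
    have h3 : (B ∩ ↑X) ∪ (⋃ P ∈ X.powerset, cls P) = B := by
      ext v
      simp only [Set.mem_union, Set.mem_inter_iff, Set.mem_iUnion]
      constructor
      · rintro (hv | ⟨P, _, hv⟩)
        · exact hv.1
        · exact hv.1
      · intro hv
        by_cases hvX : v ∈ X
        · exact Or.inl ⟨hv, hvX⟩
        · refine Or.inr ⟨X.filter (G.adj v), Finset.mem_powerset.2 (Finset.filter_subset _ _),
            hv, hvX, ?_⟩
          intro x hx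
          simp [hx]
    have h4 := G.domOn_union_le (B ∩ ↑X) (⋃ P ∈ X.powerset, cls P)
    rw [h3] at h4
    rw [Finset.card_powerset] at h1
    have h5 : 2 ^ X.card * n ≤ 2 ^ k * n :=
      Nat.mul_le_mul_right _ (Nat.pow_le_pow_right (by norm_num) hXk)
    omega
  obtain ⟨P, hP, hPn⟩ := hex
  have hP := Finset.mem_powerset.1 hP
  have hsplit : (↑P ∪ ↑(X \ P) : Set G.V) = ↑X := by
    rw [← Finset.coe_union, Finset.union_sdiff_of_subset hP]
  have h6 := G.domOn_union_le (↑P) (↑(X \ P))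
  rw [hsplit] at h6
  by_cases h7 : n ≤ G.domOn ↑P
  · refine ⟨↑P, cls P, ?_, fun v hv => hv.1, h7, hPn, Or.inr ?_⟩
    · exact fun v hv => hXA (hP hv)
    · intro b hb a ha
      exact (hb.2.2 a (hP ha)).1 ha
  · refine ⟨↑(X \ P), cls P, ?_, fun v hv => hv.1, by omega, hPn, Or.inl ?_⟩
    · exact fun v hv => hXA (Finset.mem_sdiff.1 hv).1
    · intro a ha b hb
      have ha := Finset.mem_sdiff.1 ha
      have hne : a ≠ b := fun e => hb.2.1 (e ▸ ha.1)
      rcases G.total a b hne with h | h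
      · exact h
      · exact absurd ((hb.2.2 a ha.1).2 h) ha.2

/-- `B` is weakly complete to `A`. -/
def Weak (G : Tournament) (q : ℕ) (B A : Set G.V) : Prop :=
  ∃ B' A' : Set G.V, B' ⊆ B ∧ A' ⊆ A ∧ q ≤ G.domOn B' ∧ q ≤ G.domOn A' ∧ G.CompleteTo B' A'

theorem step_bound
    (hyp : ∀ c : ℕ, ∃ K k : ℕ, 1 ≤ K ∧ 1 ≤ k ∧ ∀ G : Tournament, K ≤ G.dom →
      ∃ A : Finset G.V, A.card ≤ k ∧ c ≤ G.domOn ↑A) (T : Tournament) (D : ℕ)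
    (hT : ∀ G : Tournament, ¬ G.Contains T → G.dom ≤ D) :
    ∃ K : ℕ, ∀ G : Tournament, ¬ G.Contains (delta T T T) → G.dom ≤ K := by
  classical
  obtain ⟨q, hq, hhq⟩ := homog hyp (D + 1)
  obtain ⟨c, hc, hhc⟩ := homog hyp q
  obtain ⟨K, k, -, -, h⟩ := hyp c
  refine ⟨K + k, fun G hG => ?_⟩
  by_contra hK
  push Not at hK
  have hTG : ∀ A : Set G.V, D < G.domOn A → G.ContainsOn A T := containsOn_of hT G
  -- a type above any given type
  have hnext : ∀ A : {A : Finset G.V // A.card ≤ k ∧ c ≤ G.domOn ↑A},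
      ∃ B : {A : Finset G.V // A.card ≤ k ∧ c ≤ G.domOn ↑A},
        G.CompleteTo (↑B.1) (↑A.1) := by
    rintro ⟨A, hAk, -⟩
    have h1 : G.domOn {v | v ∈ A ∨ ∃ x ∈ A, G.adj x v} ≤ A.card :=
      G.domOn_le _ A (fun v hv => Or.inl hv) (fun v hv hv' => hv.resolve_left hv')
    have h2 := G.domOn_union_le {v | v ∈ A ∨ ∃ x ∈ A, G.adj x v} {v | ∀ x ∈ A, G.adj v x}
    have h3 : {v | v ∈ A ∨ ∃ x ∈ A, G.adj x v} ∪ {v | ∀ x ∈ A, G.adj v x} = Set.univ := by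
      rw [Set.eq_univ_iff_forall]
      intro v
      by_cases hv : v ∈ A ∨ ∃ x ∈ A, G.adj x v
      · exact Or.inl hv
      · push Not at hv
        refine Or.inr fun x hx => ?_
        rcases G.total v x (fun e => hv.1 (e ▸ hx)) with h | h
        · exact h
        · exact absurd h (hv.2 x hx)
    rw [h3] at h2
    change G.dom ≤ _ at h2
    obtain ⟨B, hB, hB'⟩ := hyp_on h G {v | ∀ x ∈ A, G.adj v x} (by omega)
    exact ⟨⟨B, hB'⟩, fun b hb a ha => hB hb a ha⟩
  choose f hf using hnext
  obtain ⟨A0, hA0⟩ := h G (by omega)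
  let Y : ℕ → {A : Finset G.V // A.card ≤ k ∧ c ≤ G.domOn ↑A} := fun n => f^[n] ⟨A0, hA0⟩
  have hY : ∀ n, G.CompleteTo (↑(Y (n+1)).1) (↑(Y n).1) := by
    intro n
    simp only [Y, Function.iterate_succ_apply']
    exact hf _
  have hYc : ∀ n, c ≤ G.domOn ↑(Y n).1 := fun n => (Y n).2.2
  have htot : ∀ i j, G.Weak q (↑(Y i).1) (↑(Y j).1) ∨ G.Weak q (↑(Y j).1) (↑(Y i).1) := by
    intro i j
    obtain ⟨A', B', h1, h2, h3, h4, h5 | h5⟩ := hhc G _ _ (hYc i) (hYc j)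
    · exact Or.inl ⟨A', B', h1, h2, h3, h4, h5⟩
    · exact Or.inr ⟨B', A', h2, h1, h4, h3, h5⟩
  -- the key property
  have hkey : ∀ i j, G.Weak q (↑(Y j).1) (↑(Y (i+1)).1) →
      ¬ G.Weak q (↑(Y i).1) (↑(Y (j+1)).1) := by
    rintro i j ⟨E, X', hE, hX', hEq, hXq', hEX⟩ ⟨X, E', hX, hE', hXq, hEq', hXE⟩
    obtain ⟨P, R, hP, hR, hPD, hRD, hPR⟩ := hhq G X' E' hXq' hEq'
    have cP := hTG P hPD
    have cR := hTG R hRD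
    have cX := hTG X (by omega)
    have cE := hTG E (by omega)
    rcases hPR with hPR | hPR
    · exact hG (contains_delta cP cR cE hPR
        (fun a ha b hb => hY j a (hE' (hR ha)) b (hE hb))
        (fun a ha b hb => hEX a ha b (hP hb)))
    · exact hG (contains_delta cP cX cR
        (fun a ha b hb => hY i a (hX' (hP ha)) b (hX hb))
        (fun a ha b hb => hXE a ha b (hR hb)) hPR)
  have hbase : ∀ m, ¬ G.Weak q (↑(Y m).1) (↑(Y (m+1)).1) := by
    rintro m ⟨B', A', hB, hA, hBq, hAq, hBA⟩
    have ne : ∀ S : Set G.V, q ≤ G.domOn S → S.Nonempty := by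
      intro S hS
      by_contra hn
      rw [Set.not_nonempty_iff_eq_empty] at hn
      have := G.domOn_le_card S ∅ (by simp [hn])
      simp at this
      omega
    obtain ⟨b, hb⟩ := ne _ hBq
    obtain ⟨a, ha⟩ := ne _ hAq
    exact G.asymm _ _ (hBA b hb a ha) (hY m a (hA ha) b (hB hb))
  have hmain : ∀ r a, ¬ G.Weak q (↑(Y a).1) (↑(Y (a + 2 * r + 1)).1) := by
    intro r
    induction r with
    | zero => intro a; exact hbase a
    | succ r ih =>
      intro a hW
      have h1 := ih (a + 1)
      have e : a + 1 + 2 * r + 1 = a + 2 * r + 2 := by ring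
      rw [e] at h1
      have h2 := (htot (a + 2 * r + 2) (a + 1)).resolve_right h1
      exact hkey (a + 2 * r + 2) a hW h2
  obtain ⟨a, b, hab, heq⟩ : ∃ a b, a < b ∧ Y a = Y b := by
    obtain ⟨a, b, hne, he⟩ := Finite.exists_ne_map_eq_of_infinite Y
    rcases lt_or_gt_of_ne hne with h | h
    · exact ⟨a, b, h, he⟩
    · exact ⟨b, a, h, he.symm⟩
  rcases Nat.even_or_odd' (b - a) with ⟨s, hs | hs⟩
  · obtain ⟨r, rfl⟩ : ∃ r, s = r + 1 := ⟨s - 1, by omega⟩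
    have h1 := hmain r a
    have e : b = a + 2 * r + 1 + 1 := by omega
    rw [heq, e] at h1
    exact h1 ⟨_, _, subset_rfl, subset_rfl, hc.trans (hYc _), hc.trans (hYc _), hY _⟩
  · have h1 := hmain s a
    have e : a + 2 * s + 1 = b := by omega
    rw [e, ← heq] at h1
    rcases htot a a with h | h <;> exact h1 h

end Tournament

open Tournament in
/-- If every tournament of large domination number has a small subtournament of
large domination number, then for every `t ≥ 1`, `T_t`-free tournaments have
bounded domination number. -/
theorem harut_implication
    (hyp : ∀ c : ℕ, ∃ K k : ℕ, 1 ≤ K ∧ 1 ≤ k ∧ ∀ G : Tournament, K ≤ G.dom →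
      ∃ A : Finset G.V, A.card ≤ k ∧ c ≤ G.domOn ↑A) :
    ∀ t : ℕ, 1 ≤ t → ∃ K : ℕ, ∀ G : Tournament,
      ¬ G.Contains (tAux (t - 1)) → G.dom ≤ K := by
  intro t _
  generalize t - 1 = n
  induction n with
  | zero =>
    refine ⟨0, fun G hG => ?_⟩
    refine (G.domOn_le_card Set.univ ∅ ?_).trans (by simp)
    intro v _
    exact (hG ⟨fun _ => v, fun _ _ _ => rfl, fun _ => trivial,
      fun _ _ => ⟨fun h => h.elim, fun h => (G.irrefl' v h).elim⟩⟩).elim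
  | succ n ih =>
    obtain ⟨D, hD⟩ := ih
    exact step_bound hyp (tAux n) D hD
end
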